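/- Let Φ ∈ ℝ^{d×d} be symmetric positive definite, with Φ-inner product ⟨x, y⟩_Φ = ⟨Φx, y⟩ and induced norm ‖·‖_Φ. Let A : ℝ^d → ℝ^d be θ-cocoercive with respect to the Euclidean inner product, and set γ = 1/‖Φ⁻¹‖ where ‖Φ⁻¹‖ is the Euclidean operator norm of Φ⁻¹. Then Φ⁻¹ ∘ A is θγ-cocoercive with respect to the Φ-inner product: for all x, y ∈ ℝ^d, ⟨Φ⁻¹A(x) − Φ⁻¹A(y), x − y⟩_Φ ≥ θγ ‖Φ⁻¹A(x) − Φ⁻¹A(y)‖²_Φ. -/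

import Mathlib

open scoped RealInnerProductSpace

/-- **Lemma 2(iii)**: if `A` is `θ`-cocoercive for the Euclidean inner product and `Φ` is
symmetric positive definite with inverse `Ψ = Φ⁻¹` and `γ = 1/‖Φ⁻¹‖`, then `Φ⁻¹ ∘ A` is
`θγ`-cocoercive with respect to the `Φ`-inner product `⟪x, y⟫_Φ = ⟪Φ x, y⟫`. -/
theorem preconditioned_operator_cocoercive
    (d : ℕ)
    (Φ Ψ : EuclideanSpace ℝ (Fin d) →L[ℝ] EuclideanSpace ℝ (Fin d))
    (hΦsymm : ∀ x y, ⟪Φ x, y⟫ = ⟪x, Φ y⟫)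
    (hΦpos : ∀ x, x ≠ 0 → 0 < ⟪Φ x, x⟫)
    (hΨ : ∀ x, Φ (Ψ x) = x ∧ Ψ (Φ x) = x)
    (A : EuclideanSpace ℝ (Fin d) → EuclideanSpace ℝ (Fin d))
    (θ : ℝ) (hθ : 0 < θ)
    (hcoco : ∀ x y, θ * ‖A x - A y‖ ^ 2 ≤ ⟪A x - A y, x - y⟫)
    (γ : ℝ) (hγ : γ = 1 / ‖Ψ‖) :
    ∀ x y,
      θ * γ * ⟪Φ (Ψ (A x) - Ψ (A y)), Ψ (A x) - Ψ (A y)⟫ ≤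
        ⟪Φ (Ψ (A x) - Ψ (A y)), x - y⟫ := by
  intro x y
  have e : Φ (Ψ (A x) - Ψ (A y)) = A x - A y := by
    rw [← map_sub, (hΨ _).1]
  rw [e, ← map_sub]
  refine le_trans ?_ (hcoco x y)
  rw [mul_assoc]
  refine mul_le_mul_of_nonneg_left ?_ hθ.le
  generalize A x - A y = u
  have h1 : ⟪u, Ψ u⟫ ≤ ‖Ψ‖ * ‖u‖ ^ 2 := by
    have h2 := real_inner_le_norm u (Ψ u)
    have h3 := mul_le_mul_of_nonneg_left (Ψ.le_opNorm u) (norm_nonneg u)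
    nlinarith
  rcases (norm_nonneg Ψ).eq_or_lt with h | h
  · rw [hγ, ← h]
    simp
  · rw [hγ, one_div, inv_mul_le_iff₀ h]
    exact h1
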